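/- Let n ≥ j+1 be an integer and i ∈ {1,2}. Then the squared Sobolev norm of the Sobolev orthogonal polynomial satisfies ‖Q_n^{(i)}‖_λ² = ‖M_n‖² + b_n^{(j)} ‖M_{n−1}‖², where ‖Q_n^{(i)}‖_λ² = ⟨Q_n^{(i)}, Q_n^{(i)}⟩_λ. -/

import Mathlib

open Finset Filter Topology Polynomial

noncomputable section

/-- Pochhammer symbol `(a)_k = a(a+1)⋯(a+k−1)`. -/
def poch (a : ℝ) (k : ℕ) : ℝ := ∏ m ∈ Finset.range k, (a + m)

/-- Falling factorial `[x]_k = x(x−1)⋯(x−k+1)`. -/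
def fall (x : ℝ) (k : ℕ) : ℝ := ∏ m ∈ Finset.range k, (x - m)

/-- `⟨x⟩_i^k`: falling factorial for `i = 1`, Pochhammer symbol for `i = 2`. -/
def br (i : ℕ) (x : ℝ) (k : ℕ) : ℝ := if i = 1 then fall x k else poch x k

/-- Forward (`i = 1`) resp. backward (`i = 2`) difference operator `𝒟_i`. -/
def Dop (i : ℕ) (f : ℝ → ℝ) : ℝ → ℝ :=
  fun x => if i = 1 then f (x + 1) - f x else f x - f (x - 1)

/-- Iterated difference operator `𝒟_i^k`. -/
def Dk (i k : ℕ) (f : ℝ → ℝ) : ℝ → ℝ := (Dop i)^[k] f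

/-- Kronecker delta `δ_{i,m}` (real valued). -/
def kdelta (i m : ℕ) : ℝ := if i = m then 1 else 0

/-- The shift `x ± 1`: `x + 1` for `i = 1`, `x - 1` for `i = 2`. -/
def sh (i : ℕ) (x : ℝ) : ℝ := if i = 1 then x + 1 else x - 1

/-- Monic Meixner polynomial `M_n(x)`. -/
def MeixnerM (γ μ : ℝ) (n : ℕ) (x : ℝ) : ℝ :=
  poch γ n * (μ / (μ - 1)) ^ n *
    ∑ k ∈ Finset.range (n + 1),
      poch (-(n : ℝ)) k * poch (-x) k / poch γ k * (1 - μ⁻¹) ^ k / (Nat.factorial k : ℝ)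

/-- Meixner inner product `⟨p,q⟩ = ∑_{x≥0} p(x)q(x) μ^x (γ)_x / x!`. -/
def mIP (γ μ : ℝ) (p q : ℝ → ℝ) : ℝ :=
  ∑' x : ℕ, p x * q x * μ ^ x * poch γ x / (Nat.factorial x : ℝ)

/-- Squared Meixner norm `‖M_n‖²`. -/
def nrm2 (γ μ : ℝ) (n : ℕ) : ℝ := mIP γ μ (MeixnerM γ μ n) (MeixnerM γ μ n)

/-- Kernel `K_n^{(l,m)}(x,y)` for the operator `𝒟_i`. -/
def Klm (γ μ : ℝ) (i l m n : ℕ) (x y : ℝ) : ℝ :=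
  ∑ k ∈ Finset.range (n + 1),
    Dk i l (MeixnerM γ μ k) x * Dk i m (MeixnerM γ μ k) y / nrm2 γ μ k

/-- Sobolev inner product `⟨p,q⟩_λ = ⟨p,q⟩ + λ 𝒟_i^j p(α) 𝒟_i^j q(α)`. -/
def sIP (γ μ lam α : ℝ) (i j : ℕ) (p q : ℝ → ℝ) : ℝ :=
  mIP γ μ p q + lam * Dk i j p α * Dk i j q α

/-- `Q` is the monic Sobolev orthogonal polynomial of degree `n`. -/
def IsSobolevOP (γ μ lam α : ℝ) (i j n : ℕ) (Q : Polynomial ℝ) : Prop :=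
  Q.Monic ∧ Q.natDegree = n ∧
    ∀ p : Polynomial ℝ, p.degree < (n : WithBot ℕ) →
      sIP γ μ lam α i j (fun x => Q.eval x) (fun x => p.eval x) = 0

/-- Coefficient `a_n^{(k)}`. -/
def acoef (γ μ lam α : ℝ) (i j n k : ℕ) : ℝ :=
  -(lam * (Nat.factorial j : ℝ) * Dk i j (MeixnerM γ μ n) α * Dk i k (MeixnerM γ μ (n - 1)) α) /
    ((Nat.factorial k : ℝ) * nrm2 γ μ (n - 1) * (1 + lam * Klm γ μ i j j (n - 1) α α))

/-- Coefficient `b_n^{(k)}`. -/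
def bcoef (γ μ lam α : ℝ) (i j n k : ℕ) : ℝ :=
  lam * (Nat.factorial j : ℝ) * Dk i j (MeixnerM γ μ n) α * Dk i k (MeixnerM γ μ n) α /
    ((Nat.factorial k : ℝ) * nrm2 γ μ (n - 1) * (1 + lam * Klm γ μ i j j (n - 1) α α))

/-- Rational function `A_{1,n}(x)`. -/
def A1 (γ μ lam α : ℝ) (i j n : ℕ) (x : ℝ) : ℝ :=
  1 + (1 / br i (x - α) (j + 1)) *
    ∑ k ∈ Finset.range (j + 1), acoef γ μ lam α i j n k * br i (x - α) k

/-- Rational function `B_{1,n}(x)`. -/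
def B1 (γ μ lam α : ℝ) (i j n : ℕ) (x : ℝ) : ℝ :=
  (1 / br i (x - α) (j + 1)) *
    ∑ k ∈ Finset.range (j + 1), bcoef γ μ lam α i j n k * br i (x - α) k

/-- Meixner recurrence coefficient `α_n`. -/
def alphaR (γ μ : ℝ) (n : ℕ) : ℝ := ((n : ℝ) * (1 + μ) + μ * γ) / (1 - μ)

/-- Meixner recurrence coefficient `β_n`. -/
def betaR (γ μ : ℝ) (n : ℕ) : ℝ := (n : ℝ) * μ * ((n : ℝ) + γ - 1) / (1 - μ) ^ 2

/-- Rational function `A_{2,n}(x)`. -/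
def A2 (γ μ lam α : ℝ) (i j n : ℕ) (x : ℝ) : ℝ :=
  -(B1 γ μ lam α i j (n - 1) x) / betaR γ μ (n - 1)

/-- Rational function `B_{2,n}(x)`. -/
def B2 (γ μ lam α : ℝ) (i j n : ℕ) (x : ℝ) : ℝ :=
  A1 γ μ lam α i j (n - 1) x + A2 γ μ lam α i j n x * (alphaR γ μ (n - 1) - x)

/-- Rational function `C_{1,n}(x)`. -/
def C1 (γ μ lam α : ℝ) (i j n : ℕ) (x : ℝ) : ℝ :=
  (x + γ * kdelta i 1) * Dop i (A1 γ μ lam α i j n) x + (n : ℝ) * A1 γ μ lam α i j n (sh i x)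
    - ((n : ℝ) - 1) * ((n : ℝ) + γ - 2) * μ ^ kdelta i 2 * B1 γ μ lam α i j n (sh i x) /
        (betaR γ μ (n - 1) * (1 - μ))

/-- Rational function `D_{1,n}(x)`. -/
def D1 (γ μ lam α : ℝ) (i j n : ℕ) (x : ℝ) : ℝ :=
  (x + γ * kdelta i 1) * Dop i (B1 γ μ lam α i j n) x
    + ((n : ℝ) - 1) * B1 γ μ lam α i j n (sh i x)
    + ((n : ℝ) - 1) * ((n : ℝ) + γ - 2) * (x - alphaR γ μ (n - 1)) * μ ^ kdelta i 2 *
        B1 γ μ lam α i j n (sh i x) / (betaR γ μ (n - 1) * (1 - μ))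
    + (n : ℝ) * ((n : ℝ) + γ - 1) * μ ^ kdelta i 2 * A1 γ μ lam α i j n (sh i x) / (1 - μ)

/-- Rational function `C_{2,n}(x)`. -/
def C2 (γ μ lam α : ℝ) (i j n : ℕ) (x : ℝ) : ℝ :=
  -(D1 γ μ lam α i j (n - 1) x) / betaR γ μ (n - 1)

/-- Rational function `D_{2,n}(x)`. -/
def D2 (γ μ lam α : ℝ) (i j n : ℕ) (x : ℝ) : ℝ :=
  C1 γ μ lam α i j (n - 1) x + C2 γ μ lam α i j n x * (alphaR γ μ (n - 1) - x)

/-- `A_{m,n}(x)` for `m = 1, 2`. -/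
def Aa (γ μ lam α : ℝ) (i j n m : ℕ) (x : ℝ) : ℝ :=
  if m = 1 then A1 γ μ lam α i j n x else A2 γ μ lam α i j n x

/-- `B_{m,n}(x)` for `m = 1, 2`. -/
def Bb (γ μ lam α : ℝ) (i j n m : ℕ) (x : ℝ) : ℝ :=
  if m = 1 then B1 γ μ lam α i j n x else B2 γ μ lam α i j n x

/-- `C_{k,n}(x)` for `k = 1, 2`. -/
def Cc (γ μ lam α : ℝ) (i j n k : ℕ) (x : ℝ) : ℝ :=
  if k = 1 then C1 γ μ lam α i j n x else C2 γ μ lam α i j n x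

/-- `D_{k,n}(x)` for `k = 1, 2`. -/
def Dd (γ μ lam α : ℝ) (i j n k : ℕ) (x : ℝ) : ℝ :=
  if k = 1 then D1 γ μ lam α i j n x else D2 γ μ lam α i j n x

/-- `Λ_{m,n}^{(k)}(x) = (−1)^k (C_{k,n}(x) B_{m,n}(x) − A_{m,n}(x) D_{k,n}(x))`. -/
def Lam (γ μ lam α : ℝ) (i j n m k : ℕ) (x : ℝ) : ℝ :=
  (-1 : ℝ) ^ k * (Cc γ μ lam α i j n k x * Bb γ μ lam α i j n m x
    - Aa γ μ lam α i j n m x * Dd γ μ lam α i j n k x)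

/-- `Θ_n(x) = A_{1,n}(x) B_{2,n}(x) − B_{1,n}(x) A_{2,n}(x)`. -/
def Theta (γ μ lam α : ℝ) (i j n : ℕ) (x : ℝ) : ℝ :=
  A1 γ μ lam α i j n x * B2 γ μ lam α i j n x - B1 γ μ lam α i j n x * A2 γ μ lam α i j n x

/-- `Θ̃_n(x) = (x + γ δ_{i,1}) Θ_n(x)`. -/
def Thetatil (γ μ lam α : ℝ) (i j n : ℕ) (x : ℝ) : ℝ :=
  (x + γ * kdelta i 1) * Theta γ μ lam α i j n x

/-! ### Pochhammer symbols -/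

lemma poch_zero (a : ℝ) : poch a 0 = 1 := by simp [poch]

lemma poch_pos {a : ℝ} (ha : 0 < a) (k : ℕ) : 0 < poch a k :=
  Finset.prod_pos fun m _ => by positivity

lemma poch_succ_right (a : ℝ) (k : ℕ) : poch a (k + 1) = poch a k * (a + k) :=
  Finset.prod_range_succ _ _

lemma poch_add (a : ℝ) (m k : ℕ) : poch a (m + k) = poch a m * poch (a + m) k := by
  simp only [poch, Finset.prod_range_add, Nat.cast_add, add_assoc]

lemma poch_succ_left (a : ℝ) (k : ℕ) : poch a (k + 1) = a * poch (a + 1) k := by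
  rw [add_comm, poch_add]; simp [poch]

lemma poch_mul_comm (a : ℝ) (m k : ℕ) :
    poch a m * poch (a + m) k = poch a k * poch (a + k) m := by
  rw [← poch_add, ← poch_add, add_comm]

lemma poch_eq_eval (a : ℝ) (k : ℕ) : poch a k = (ascPochhammer ℝ k).eval a := by
  induction k with
  | zero => simp [poch]
  | succ k ih => rw [poch_succ_right, ascPochhammer_succ_eval, ih]

lemma poch_neg (x : ℝ) (k : ℕ) : poch (-x) k = (-1) ^ k * (descPochhammer ℝ k).eval x := by
  rw [poch_eq_eval, ascPochhammer_eval_neg_eq_descPochhammer]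

lemma poch_neg_natCast (n k : ℕ) :
    poch (-(n : ℝ)) k = (-1) ^ k * (n.choose k * k.factorial) := by
  rw [poch_neg, descPochhammer_eval_eq_descFactorial, Nat.descFactorial_eq_factorial_mul_choose]
  push_cast; ring

/-! ### The Meixner weight and its moment functional -/

/-- The Meixner weight `μ^x (a)_x / x!`. -/
def meixnerWeight (μ a : ℝ) (x : ℕ) : ℝ := μ ^ x * poch a x / (Nat.factorial x : ℝ)

lemma meixnerWeight_pos {μ a : ℝ} (hμ : 0 < μ) (ha : 0 < a) (x : ℕ) :
    0 < meixnerWeight μ a x := by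
  have := poch_pos ha x
  unfold meixnerWeight
  positivity

lemma meixnerWeight_succ (μ a : ℝ) (x : ℕ) :
    ((x : ℝ) + 1) * meixnerWeight μ a (x + 1) = μ * a * meixnerWeight μ (a + 1) x := by
  have := Nat.factorial_pos x
  rw [meixnerWeight, meixnerWeight, poch_succ_left, Nat.factorial_succ]
  push_cast
  field_simp
  ring

lemma natCast_mul_meixnerWeight (μ a : ℝ) (x : ℕ) :
    (x : ℝ) * meixnerWeight μ a x =
      a * (meixnerWeight μ (a + 1) x - meixnerWeight μ a x) := by
  have h : a * poch (a + 1) x = poch a x * (a + x) := by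
    rw [← poch_succ_left, poch_succ_right]
  simp only [meixnerWeight]
  linear_combination -(μ ^ x / (Nat.factorial x : ℝ)) * h

lemma poch_add_mul_meixnerWeight (μ a : ℝ) (m x : ℕ) :
    poch (x + a) m * meixnerWeight μ a x = poch a m * meixnerWeight μ (a + m) x := by
  have h := poch_mul_comm a m x
  simp only [meixnerWeight]
  rw [add_comm (x : ℝ) a]
  linear_combination -(μ ^ x / (Nat.factorial x : ℝ)) * h

lemma summable_meixnerWeight {μ a : ℝ} (hμ0 : 0 < μ) (hμ1 : μ < 1) (ha : 0 < a) :
    Summable (meixnerWeight μ a) := by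
  refine summable_of_ratio_test_tendsto_lt_one hμ1
    (Eventually.of_forall fun x => (meixnerWeight_pos hμ0 ha x).ne') ?_
  have h : ∀ x : ℕ, ‖meixnerWeight μ a (x + 1)‖ / ‖meixnerWeight μ a x‖ =
      μ * (1 + (a - 1) / ((x : ℝ) + 1)) := by
    intro x
    rw [Real.norm_of_nonneg (meixnerWeight_pos hμ0 ha _).le,
      Real.norm_of_nonneg (meixnerWeight_pos hμ0 ha _).le,
      div_eq_iff (meixnerWeight_pos hμ0 ha x).ne', meixnerWeight, meixnerWeight,
      poch_succ_right, Nat.factorial_succ]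
    push_cast
    have := Nat.factorial_pos x
    field_simp
    ring
  simp only [h]
  have h0 : Tendsto (fun x : ℕ => (a - 1) / ((x : ℝ) + 1)) atTop (𝓝 0) :=
    tendsto_const_nhds.div_atTop
      (tendsto_natCast_atTop_atTop.atTop_add tendsto_const_nhds)
  simpa using (h0.const_add 1).const_mul μ

lemma summable_pow_mul_meixnerWeight {μ : ℝ} (hμ0 : 0 < μ) (hμ1 : μ < 1) (d : ℕ) {a : ℝ}
    (ha : 0 < a) : Summable fun x : ℕ => (x : ℝ) ^ d * meixnerWeight μ a x := by
  induction d generalizing a with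
  | zero => simpa using summable_meixnerWeight hμ0 hμ1 ha
  | succ d ih =>
    refine (((ih (a := a + 1) (by linarith)).sub (ih ha)).mul_left a).congr fun x => ?_
    linear_combination -(x : ℝ) ^ d * natCast_mul_meixnerWeight μ a x

lemma summable_eval_mul_meixnerWeight {μ a : ℝ} (hμ0 : 0 < μ) (hμ1 : μ < 1) (ha : 0 < a)
    (p : ℝ[X]) : Summable fun x : ℕ => p.eval (x : ℝ) * meixnerWeight μ a x := by
  induction p using Polynomial.induction_on' with
  | add p q hp hq => simpa only [eval_add, add_mul] using hp.add hq
  | monomial d c =>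
    simpa only [eval_monomial, mul_assoc] using
      (summable_pow_mul_meixnerWeight hμ0 hμ1 d ha).mul_left c

/-- The linear functional `p ↦ ∑_x p(x) μ^x (γ)_x / x!` on polynomials. -/
def meixnerMoment {γ μ : ℝ} (hγ : 0 < γ) (hμ0 : 0 < μ) (hμ1 : μ < 1) : ℝ[X] →ₗ[ℝ] ℝ where
  toFun p := ∑' x : ℕ, p.eval (x : ℝ) * meixnerWeight μ γ x
  map_add' p q := by
    simp only [eval_add, add_mul]
    exact (summable_eval_mul_meixnerWeight hμ0 hμ1 hγ p).tsum_add
      (summable_eval_mul_meixnerWeight hμ0 hμ1 hγ q)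
  map_smul' c p := by
    simp only [eval_smul, smul_eq_mul, mul_assoc, RingHom.id_apply, tsum_mul_left]

section Moment

variable {γ μ : ℝ} (hγ : 0 < γ) (hμ0 : 0 < μ) (hμ1 : μ < 1)

lemma meixnerMoment_apply (p : ℝ[X]) : meixnerMoment hγ hμ0 hμ1 p =
    ∑' x : ℕ, p.eval (x : ℝ) * meixnerWeight μ γ x := rfl

lemma mIP_eval (p q : ℝ[X]) :
    mIP γ μ (fun x => p.eval x) (fun x => q.eval x) = meixnerMoment hγ hμ0 hμ1 (p * q) := by
  rw [mIP, meixnerMoment_apply]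
  refine tsum_congr fun x => ?_
  rw [eval_mul, meixnerWeight]
  ring

lemma meixnerMoment_sq_pos {p : ℝ[X]} (hp : p ≠ 0) : 0 < meixnerMoment hγ hμ0 hμ1 (p * p) := by
  obtain ⟨x, hx⟩ : ∃ x : ℕ, p.eval (x : ℝ) ≠ 0 := by
    by_contra! h
    refine hp (Polynomial.eq_zero_of_infinite_isRoot p ?_)
    refine (Set.infinite_range_of_injective (Nat.cast_injective (R := ℝ))).mono ?_
    rintro _ ⟨x, rfl⟩
    exact h x
  rw [meixnerMoment_apply]
  refine (summable_eval_mul_meixnerWeight hμ0 hμ1 hγ (p * p)).tsum_pos (fun y => ?_) x ?_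
  · rw [eval_mul]
    exact mul_nonneg (mul_self_nonneg _) (meixnerWeight_pos hμ0 hγ y).le
  · rw [eval_mul]
    exact mul_pos (mul_self_pos.2 hx) (meixnerWeight_pos hμ0 hγ x)

end Moment

lemma tsum_descPochhammer_succ_mul_meixnerWeight {μ a : ℝ} (hμ0 : 0 < μ) (hμ1 : μ < 1)
    (ha : 0 < a) (k : ℕ) :
    ∑' x : ℕ, (descPochhammer ℝ (k + 1)).eval (x : ℝ) * meixnerWeight μ a x =
      μ * a * ∑' x : ℕ, (descPochhammer ℝ k).eval (x : ℝ) * meixnerWeight μ (a + 1) x := by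
  rw [(summable_eval_mul_meixnerWeight hμ0 hμ1 ha _).tsum_eq_zero_add, ← tsum_mul_left]
  simp only [Nat.cast_zero, descPochhammer_eval_zero, Nat.succ_ne_zero, if_false, zero_mul,
    zero_add]
  refine tsum_congr fun x => ?_
  have h : (descPochhammer ℝ (k + 1)).eval ((x : ℝ) + 1) =
      ((x : ℝ) + 1) * (descPochhammer ℝ k).eval (x : ℝ) := by
    simp [descPochhammer_succ_left]
  push_cast
  rw [h]
  linear_combination (descPochhammer ℝ k).eval (x : ℝ) * meixnerWeight_succ μ a x

lemma tsum_meixnerWeight_add_one {μ a : ℝ} (hμ0 : 0 < μ) (hμ1 : μ < 1) (ha : 0 < a) :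
    ∑' x, meixnerWeight μ (a + 1) x = (∑' x, meixnerWeight μ a x) / (1 - μ) := by
  have h := tsum_descPochhammer_succ_mul_meixnerWeight hμ0 hμ1 ha 0
  have hs := summable_meixnerWeight hμ0 hμ1 ha
  have hs' := summable_meixnerWeight hμ0 hμ1 (a := a + 1) (by linarith)
  simp only [zero_add, descPochhammer_one, descPochhammer_zero, eval_X, eval_one, one_mul,
    natCast_mul_meixnerWeight, tsum_mul_left, hs'.tsum_sub hs] at h
  rw [eq_div_iff (by linarith)]
  refine mul_left_cancel₀ ha.ne' ?_
  linear_combination h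

lemma tsum_descPochhammer_mul_meixnerWeight {μ : ℝ} (hμ0 : 0 < μ) (hμ1 : μ < 1) (k : ℕ) {a : ℝ}
    (ha : 0 < a) :
    ∑' x : ℕ, (descPochhammer ℝ k).eval (x : ℝ) * meixnerWeight μ a x =
      (μ / (1 - μ)) ^ k * poch a k * ∑' x, meixnerWeight μ a x := by
  induction k generalizing a with
  | zero => simp [poch_zero]
  | succ k ih =>
    rw [tsum_descPochhammer_succ_mul_meixnerWeight hμ0 hμ1 ha, ih (by linarith),
      tsum_meixnerWeight_add_one hμ0 hμ1 ha, poch_succ_left]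
    ring

lemma sum_alternating_choose_mul_eval (p : ℝ[X]) {n : ℕ} (h : p.natDegree < n) :
    ∑ k ∈ Finset.range (n + 1), (-1 : ℝ) ^ k * n.choose k * p.eval (k : ℝ) = 0 := by
  have h0 := congrFun (Polynomial.fwdDiff_iter_eq_zero_of_degree_lt h) 0
  rw [fwdDiff_iter_eq_sum_shift] at h0
  have h1 := congrArg (fun t : ℝ => (-1) ^ n * t) h0
  simp only [Pi.zero_apply, mul_zero, Finset.mul_sum] at h1
  rw [← h1]
  refine Finset.sum_congr rfl fun k hk => ?_
  obtain ⟨l, rfl⟩ := Nat.exists_eq_add_of_le (Nat.lt_succ_iff.1 (Finset.mem_range.1 hk))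
  simp only [add_tsub_cancel_left, zsmul_eq_mul, Int.cast_mul, Int.cast_pow, Int.cast_neg,
    Int.cast_one, Int.cast_natCast, nsmul_eq_mul, mul_one, zero_add, pow_add]
  have hl : (-1 : ℝ) ^ l * (-1) ^ l = 1 := by rw [← mul_pow]; simp
  linear_combination -((-1 : ℝ) ^ k * ((k + l).choose k) * p.eval (k : ℝ)) * hl

/-! ### Meixner polynomials -/

/-- The coefficients of the monic Meixner polynomial in the falling factorial basis. -/
def meixnerCoeff (γ μ : ℝ) (n k : ℕ) : ℝ :=
  poch γ n * (μ / (μ - 1)) ^ n * (n.choose k / poch γ k * (1 - μ⁻¹) ^ k)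

/-- The monic Meixner polynomial as an element of `ℝ[X]`. -/
def meixnerPoly (γ μ : ℝ) (n : ℕ) : ℝ[X] :=
  ∑ k ∈ Finset.range (n + 1), meixnerCoeff γ μ n k • descPochhammer ℝ k

lemma eval_meixnerPoly (γ μ : ℝ) (n : ℕ) :
    (fun x => (meixnerPoly γ μ n).eval x) = MeixnerM γ μ n := by
  funext x
  rw [meixnerPoly, MeixnerM, eval_finsetSum, Finset.mul_sum]
  refine Finset.sum_congr rfl fun k _ => ?_
  rw [eval_smul, meixnerCoeff, poch_neg_natCast, poch_neg, smul_eq_mul]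
  have hk : (-1 : ℝ) ^ k * (-1) ^ k = 1 := by rw [← mul_pow]; simp
  have := Nat.factorial_pos k
  have hf : (-1 : ℝ) ^ k * (-1) ^ k * ((k.factorial : ℝ) * (k.factorial : ℝ)⁻¹) = 1 := by
    rw [hk, one_mul, mul_inv_cancel₀ (by positivity)]
  simp only [div_eq_mul_inv]
  linear_combination (-(poch γ n * (μ * (μ - 1)⁻¹) ^ n * n.choose k * (poch γ k)⁻¹ *
    (1 - μ⁻¹) ^ k * (descPochhammer ℝ k).eval x)) * hf

lemma meixnerCoeff_self {γ μ : ℝ} (hγ : 0 < γ) (hμ0 : 0 < μ) (hμ1 : μ < 1) (n : ℕ) :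
    meixnerCoeff γ μ n n = 1 := by
  have h1 : μ / (μ - 1) * (1 - μ⁻¹) = 1 := by
    have : μ - 1 ≠ 0 := by linarith
    field_simp
  have h2 := (poch_pos hγ n).ne'
  have h3 : (μ / (μ - 1)) ^ n * (1 - μ⁻¹) ^ n = 1 := by rw [← mul_pow, h1, one_pow]
  rw [meixnerCoeff, Nat.choose_self]
  calc _ = poch γ n / poch γ n * ((μ / (μ - 1)) ^ n * (1 - μ⁻¹) ^ n) := by push_cast; ring
    _ = 1 := by rw [h3, div_self h2, one_mul]

lemma meixnerPoly_monic_natDegree {γ μ : ℝ} (hγ : 0 < γ) (hμ0 : 0 < μ) (hμ1 : μ < 1) (n : ℕ) :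
    (meixnerPoly γ μ n).Monic ∧ (meixnerPoly γ μ n).natDegree = n := by
  have hd : (descPochhammer ℝ n).degree = n := by
    rw [degree_eq_natDegree (monic_descPochhammer ℝ n).ne_zero, descPochhammer_natDegree]
  have hlt : (∑ k ∈ Finset.range n, meixnerCoeff γ μ n k • descPochhammer ℝ k).degree <
      (descPochhammer ℝ n).degree := by
    rw [hd]
    refine (Finset.sup_lt_iff (show (⊥ : WithBot ℕ) < (n : WithBot ℕ) from WithBot.bot_lt_coe n)).2
      (fun k hk => ?_) |>.trans_le'
      (degree_sum_le _ _)
    refine (degree_smul_le _ _).trans_lt ?_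
    rw [degree_eq_natDegree (monic_descPochhammer ℝ k).ne_zero, descPochhammer_natDegree]
    exact_mod_cast Finset.mem_range.1 hk
  rw [meixnerPoly, Finset.sum_range_succ, meixnerCoeff_self hγ hμ0 hμ1, one_smul]
  refine ⟨(monic_descPochhammer ℝ n).add_of_right hlt, ?_⟩
  rw [natDegree_add_eq_right_of_degree_lt hlt, descPochhammer_natDegree]

/-- A family of monic polynomials, one in each degree, generates the polynomials of degree less
than `n` under repeated addition of multiples of its first `n` members. -/
lemma monic_family_induction {P : ℕ → ℝ[X]} (hP : ∀ k, (P k).Monic ∧ (P k).natDegree = k)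
    {n : ℕ} {C : ℝ[X] → Prop} (h0 : C 0)
    (hadd : ∀ k < n, ∀ (c : ℝ) (p : ℝ[X]), C p → C (p + c • P k)) (p : ℝ[X])
    (hp : p.degree < (n : WithBot ℕ)) : C p := by
  suffices h : ∀ d ≤ n, ∀ p : ℝ[X], p.degree < (d : WithBot ℕ) → C p from h n le_rfl p hp
  intro d
  induction d with
  | zero =>
    intro _ p hp
    have : p = 0 := by
      rw [← degree_eq_bot]
      exact Nat.WithBot.lt_zero_iff.1 (by simpa using hp)
    rwa [this]
  | succ d ih =>
    intro hd p hp
    have hc : (P d).coeff d = 1 := by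
      have := (hP d).1.coeff_natDegree
      rwa [(hP d).2] at this
    have key : (p - p.coeff d • P d).degree < (d : WithBot ℕ) := by
      rw [degree_lt_iff_coeff_zero]
      intro m hm
      rcases hm.eq_or_lt with rfl | hm
      · simp [hc]
      · rw [coeff_sub, coeff_smul, (degree_lt_iff_coeff_zero p (d + 1)).1 hp m hm,
          coeff_eq_zero_of_natDegree_lt (p := P d) (by rwa [(hP d).2])]
        simp
    simpa using hadd d (by omega) (p.coeff d) _ (ih (by omega) _ key)

lemma meixnerMoment_meixnerPoly_mul_ascPochhammer {γ μ : ℝ} (hγ : 0 < γ) (hμ0 : 0 < μ)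
    (hμ1 : μ < 1) {n m : ℕ} (hmn : m < n) :
    meixnerMoment hγ hμ0 hμ1 (meixnerPoly γ μ n * (ascPochhammer ℝ m).comp (X + C γ)) = 0 := by
  have hterm : ∀ k, meixnerMoment hγ hμ0 hμ1
      (descPochhammer ℝ k * (ascPochhammer ℝ m).comp (X + C γ)) =
      poch γ m * ((μ / (1 - μ)) ^ k * poch (γ + m) k * ∑' x, meixnerWeight μ (γ + m) x) := by
    intro k
    rw [meixnerMoment_apply, ← tsum_descPochhammer_mul_meixnerWeight hμ0 hμ1 k
      (a := γ + m) (by positivity), ← tsum_mul_left]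
    refine tsum_congr fun x => ?_
    rw [eval_mul, eval_comp, eval_add, eval_X, eval_C, ← poch_eq_eval]
    linear_combination (descPochhammer ℝ k).eval (x : ℝ) * poch_add_mul_meixnerWeight μ γ m x
  have hdeg : ((ascPochhammer ℝ m).comp (X + C γ)).natDegree < n := by
    rwa [natDegree_comp, natDegree_X_add_C, mul_one, ascPochhammer_natDegree]
  have h0 := sum_alternating_choose_mul_eval _ hdeg
  rw [meixnerPoly, Finset.sum_mul, map_sum]
  simp only [smul_mul_assoc, map_smul, hterm, smul_eq_mul]
  have hsum : ∀ k ∈ Finset.range (n + 1), meixnerCoeff γ μ n k *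
      (poch γ m * ((μ / (1 - μ)) ^ k * poch (γ + m) k * ∑' x, meixnerWeight μ (γ + m) x)) =
      (poch γ n * (μ / (μ - 1)) ^ n * ∑' x, meixnerWeight μ (γ + m) x) *
      ((-1 : ℝ) ^ k * n.choose k * ((ascPochhammer ℝ m).comp (X + C γ)).eval (k : ℝ)) := by
    intro k _
    have h1 : (1 - μ⁻¹) ^ k * (μ / (1 - μ)) ^ k = (-1) ^ k := by
      rw [← mul_pow]
      have : 1 - μ ≠ 0 := by linarith
      congr 1
      field_simp
      ring
    have h2 : (poch γ k)⁻¹ * (poch γ m * poch (γ + m) k) = poch (γ + k) m := by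
      rw [poch_mul_comm, inv_mul_cancel_left₀ (poch_pos hγ k).ne']
    rw [eval_comp, eval_add, eval_X, eval_C, ← poch_eq_eval, add_comm (k : ℝ) γ, ← h1, ← h2,
      meixnerCoeff]
    ring
  rw [Finset.sum_congr rfl hsum, ← Finset.mul_sum, h0, mul_zero]

lemma meixnerMoment_meixnerPoly_mul {γ μ : ℝ} (hγ : 0 < γ) (hμ0 : 0 < μ) (hμ1 : μ < 1) (n : ℕ)
    (p : ℝ[X]) (hp : p.degree < (n : WithBot ℕ)) :
    meixnerMoment hγ hμ0 hμ1 (meixnerPoly γ μ n * p) = 0 := by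
  refine monic_family_induction (P := fun m => (ascPochhammer ℝ m).comp (X + C γ))
    (C := fun p => meixnerMoment hγ hμ0 hμ1 (meixnerPoly γ μ n * p) = 0)
    (fun m => ⟨(monic_ascPochhammer ℝ m).comp_X_add_C γ, ?_⟩) ?_ ?_ p hp
  · rw [natDegree_comp, natDegree_X_add_C, mul_one, ascPochhammer_natDegree]
  · simp
  · intro k hk c p hp
    rw [mul_add, map_add, hp, mul_smul_comm, map_smul,
      meixnerMoment_meixnerPoly_mul_ascPochhammer hγ hμ0 hμ1 hk, smul_zero, add_zero]

/-! ### The Sobolev norm -/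

lemma Dop_add (i : ℕ) (f g : ℝ → ℝ) : Dop i (f + g) = Dop i f + Dop i g := by
  funext x; simp only [Dop, Pi.add_apply]; split_ifs <;> ring

lemma Dop_smul (i : ℕ) (c : ℝ) (f : ℝ → ℝ) : Dop i (c • f) = c • Dop i f := by
  funext x; simp only [Dop, Pi.smul_apply, smul_eq_mul]; split_ifs <;> ring

lemma Dk_succ (i k : ℕ) (f : ℝ → ℝ) : Dk i (k + 1) f = Dk i k (Dop i f) := rfl

lemma Dk_add (i k : ℕ) (f g : ℝ → ℝ) : Dk i k (f + g) = Dk i k f + Dk i k g := by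
  induction k generalizing f g with
  | zero => rfl
  | succ k ih => simp only [Dk_succ, Dop_add, ih]

lemma Dk_smul (i k : ℕ) (c : ℝ) (f : ℝ → ℝ) : Dk i k (c • f) = c • Dk i k f := by
  induction k generalizing f with
  | zero => rfl
  | succ k ih => simp only [Dk_succ, Dop_smul, ih]

/-- The linear functional `p ↦ 𝒟_i^j p(α)` on polynomials. -/
def diffEval (i j : ℕ) (α : ℝ) : ℝ[X] →ₗ[ℝ] ℝ where
  toFun p := Dk i j (fun x => p.eval x) α
  map_add' p q := by
    rw [← Pi.add_apply (Dk i j _), ← Dk_add]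
    simp only [eval_add]
    rfl
  map_smul' c p := by
    rw [RingHom.id_apply, ← Pi.smul_apply c (Dk i j _), ← Dk_smul]
    simp only [eval_smul]
    rfl

lemma diffEval_apply (i j : ℕ) (α : ℝ) (p : ℝ[X]) :
    diffEval i j α p = Dk i j (fun x => p.eval x) α := rfl

/-- The squared norm of a monic orthogonal polynomial after adding the rank one perturbation
`lam * L p * L q` to the inner product `T (p * q)`. -/
lemma norm_of_rank_one_perturbation (T L : ℝ[X] →ₗ[ℝ] ℝ) {P : ℕ → ℝ[X]}
    (hP : ∀ k, (P k).Monic ∧ (P k).natDegree = k)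
    (horth : ∀ (k : ℕ), ∀ p : ℝ[X], p.degree < (k : WithBot ℕ) → T (P k * p) = 0)
    (hpos : ∀ k, 0 < T (P k * P k)) {lam : ℝ} (hlam : 0 < lam) {n : ℕ} {Q : ℝ[X]}
    (hQ : Q.Monic) (hQn : Q.natDegree = n)
    (hQorth : ∀ p : ℝ[X], p.degree < (n : WithBot ℕ) → T (Q * p) + lam * L Q * L p = 0) :
    T (Q * Q) + lam * L Q * L Q = T (P n * P n) + lam * L (P n) * L (P n) /
      (1 + lam * ∑ k ∈ Finset.range n, L (P k) * L (P k) / T (P k * P k)) := by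
  have hdeg : ∀ k : ℕ, (P k).degree = (k : WithBot ℕ) := fun k => by
    rw [degree_eq_natDegree (hP k).1.ne_zero, (hP k).2]
  have hQdeg : Q.degree = (n : WithBot ℕ) := by rw [degree_eq_natDegree hQ.ne_zero, hQn]
  have hsub : (Q - P n).degree < (n : WithBot ℕ) := by
    have := degree_sub_lt_left (hQdeg.trans (hdeg n).symm) hQ.ne_zero
      (by rw [hQ.leadingCoeff, (hP n).1.leadingCoeff])
    rwa [hQdeg] at this
  have horth' : ∀ k l, k ≠ l → T (P k * P l) = 0 := by
    intro k l hkl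
    rcases lt_or_gt_of_ne hkl with h | h
    · rw [mul_comm]
      exact horth l _ (by rw [hdeg]; exact_mod_cast h)
    · exact horth k _ (by rw [hdeg]; exact_mod_cast h)
  have hexp : L (Q - P n) = ∑ k ∈ Finset.range n, T (P k * (Q - P n)) / T (P k * P k) * L (P k) := by
    refine monic_family_induction (C := fun p => L p =
      ∑ k ∈ Finset.range n, T (P k * p) / T (P k * P k) * L (P k)) hP ?_ ?_ _ hsub
    · simp
    · intro l hl c p hp
      simp only [mul_add, map_add, mul_smul_comm, map_smul, smul_eq_mul, add_div, add_mul,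
        Finset.sum_add_distrib, hp]
      congr 1
      rw [Finset.sum_eq_single l]
      · rw [mul_div_assoc, div_self (hpos l).ne', mul_one]
      · intro k _ hk
        simp [horth' k l hk]
      · exact fun h => absurd (Finset.mem_range.2 hl) h
  have hcoef : ∀ k ∈ Finset.range n, T (P k * (Q - P n)) / T (P k * P k) * L (P k) =
      -(lam * L Q) * (L (P k) * L (P k) / T (P k * P k)) := by
    intro k hk
    have hk := Finset.mem_range.1 hk
    have h := hQorth (P k) (by rw [hdeg]; exact_mod_cast hk)
    rw [mul_sub, map_sub, horth' k n hk.ne, sub_zero, mul_comm (P k) Q,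
      eq_neg_of_add_eq_zero_left h]
    ring
  rw [Finset.sum_congr rfl hcoef, ← Finset.mul_sum, map_sub] at hexp
  set K := ∑ k ∈ Finset.range n, L (P k) * L (P k) / T (P k * P k)
  have hK0 : 0 ≤ K := Finset.sum_nonneg fun k _ => div_nonneg (mul_self_nonneg _) (hpos k).le
  have hden : 0 < 1 + lam * K := by positivity
  have h1 : L Q = L (P n) / (1 + lam * K) := by
    rw [eq_div_iff hden.ne']
    linear_combination hexp
  have h2 := hQorth _ hsub
  have h3 := horth n _ hsub
  rw [mul_sub, map_sub, map_sub] at h2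
  rw [mul_sub, map_sub, mul_comm (P n) Q] at h3
  have h4 : T (Q * Q) + lam * L Q * L Q = T (P n * P n) + lam * L (P n) * L Q := by
    linear_combination h2 + h3
  rw [h4, h1, mul_div_assoc]

/-- squared Sobolev norm `‖Q_n^{(i)}‖_λ² = ‖M_n‖² + b_n^{(j)} ‖M_{n−1}‖²`. -/
theorem sobolev_norm_formula (γ μ lam α : ℝ) (hγ : 0 < γ) (hμ0 : 0 < μ)
    (hμ1 : μ < 1) (hlam : 0 < lam) (hα : α ≤ 0) (j i n : ℕ) (hi : i = 1 ∨ i = 2)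
    (hn : j + 1 ≤ n) (Q : Polynomial ℝ) (hQ : IsSobolevOP γ μ lam α i j n Q) :
    sIP γ μ lam α i j (fun x => Q.eval x) (fun x => Q.eval x) =
      nrm2 γ μ n + bcoef γ μ lam α i j n j * nrm2 γ μ (n - 1) := by
  obtain ⟨hQm, hQn, hQorth⟩ := hQ
  have hs : ∀ p q : ℝ[X], sIP γ μ lam α i j (fun x => p.eval x) (fun x => q.eval x) =
      meixnerMoment hγ hμ0 hμ1 (p * q) + lam * diffEval i j α p * diffEval i j α q := fun p q => by
    rw [sIP, mIP_eval hγ hμ0 hμ1]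
    rfl
  have hP := meixnerPoly_monic_natDegree hγ hμ0 hμ1
  have hpos : ∀ k, 0 < meixnerMoment hγ hμ0 hμ1 (meixnerPoly γ μ k * meixnerPoly γ μ k) :=
    fun k => meixnerMoment_sq_pos hγ hμ0 hμ1 (hP k).1.ne_zero
  have hnrm : ∀ k, nrm2 γ μ k =
      meixnerMoment hγ hμ0 hμ1 (meixnerPoly γ μ k * meixnerPoly γ μ k) := fun k => by
    rw [nrm2, ← eval_meixnerPoly, mIP_eval hγ hμ0 hμ1]
  have hL : ∀ k, Dk i j (MeixnerM γ μ k) α = diffEval i j α (meixnerPoly γ μ k) := fun k => by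
    rw [← eval_meixnerPoly, diffEval_apply]
  rw [hs, norm_of_rank_one_perturbation (meixnerMoment hγ hμ0 hμ1) (diffEval i j α) hP
    (meixnerMoment_meixnerPoly_mul hγ hμ0 hμ1) hpos hlam hQm hQn
    (fun p hp => by rw [← hs]; exact hQorth p hp)]
  have hn1 : n - 1 + 1 = n := by omega
  simp only [bcoef, Klm, hnrm, hL, hn1]
  congr 1
  have hj : (j.factorial : ℝ) ≠ 0 := by exact_mod_cast j.factorial_ne_zero
  have hT := (hpos (n - 1)).ne'
  field_simp
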